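/- Assume 2·T_H(λ) ≤ L. Then for every x₀ with T_H(λ) ≤ x₀ ≤ L − T_H(λ), the function w_{x₀}(x) := û_λ(x − x₀) restricted to [0,L] is a nonnegative solution of the BVP, and the map x₀ ↦ w_{x₀} is injective. Consequently, if λ > Σ₁(p) then the BVP has uncountably many distinct nonnegative solutions. -/

import Mathlib

/-- The extinction time `T_H(λ) = π/((1-p)·√λ)`. -/
noncomputable def TH (p lam : ℝ) : ℝ := Real.pi / ((1 - p) * Real.sqrt lam)

/-- The maximum value `u_H(λ) = (2a/((p+1)λ))^{1/(1-p)}` of the degenerate homoclinic. -/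
noncomputable def uH (a p lam : ℝ) : ℝ := (2 * a / ((p + 1) * lam)) ^ (1 / (1 - p))

/-- The degenerate homoclinic solution `û_λ`. -/
noncomputable def uhat (a p lam x : ℝ) : ℝ :=
  if |x| ≤ TH p lam then
    uH a p lam * Real.cos ((1 - p) * Real.sqrt lam * x / 2) ^ (2 / (1 - p))
  else 0

/-- A nonnegative solution of the boundary value problem
`u'' + λu - a u^p = 0` in `[0,L]`, `u(0) = u(L) = 0`. -/
def IsNonnegSolution (a L p lam : ℝ) (u : ℝ → ℝ) : Prop :=
  ContDiffOn ℝ 2 u (Set.Icc 0 L) ∧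
  (∀ x ∈ Set.Icc (0 : ℝ) L, 0 ≤ u x) ∧
  u 0 = 0 ∧ u L = 0 ∧
  ∀ x ∈ Set.Icc (0 : ℝ) L,
    iteratedDerivWithin 2 u (Set.Icc 0 L) x + lam * u x - a * u x ^ p = 0

/-- The function `cos ^ r` on `[-π/2, π/2]`, extended by zero. -/
noncomputable def truncCosPow (r y : ℝ) : ℝ :=
  if |y| ≤ Real.pi / 2 then Real.cos y ^ r else 0

theorem cos_eq_zero_of_abs_eq {y : ℝ} (h : |y| = Real.pi / 2) : Real.cos y = 0 := by
  rw [← Real.cos_abs, h, Real.cos_pi_div_two]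

theorem cos_nonneg_of_abs_le {y : ℝ} (h : |y| ≤ Real.pi / 2) : 0 ≤ Real.cos y :=
  Real.cos_nonneg_of_mem_Icc (abs_le.mp h)

theorem truncCosPow_nonneg (r y : ℝ) : 0 ≤ truncCosPow r y := by
  unfold truncCosPow
  split_ifs with h
  · exact Real.rpow_nonneg (cos_nonneg_of_abs_le h) r
  · exact le_rfl

theorem truncCosPow_of_le_abs {r y : ℝ} (hr : r ≠ 0) (h : Real.pi / 2 ≤ |y|) :
    truncCosPow r y = 0 := by
  unfold truncCosPow
  split_ifs with h'
  · rw [cos_eq_zero_of_abs_eq (le_antisymm h' h), Real.zero_rpow hr]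
  · rfl

theorem continuous_truncCosPow {r : ℝ} (hr : 0 < r) : Continuous (truncCosPow r) := by
  unfold truncCosPow
  refine Continuous.if_le (Real.continuous_cos.rpow_const fun _ => Or.inr hr.le)
    continuous_const continuous_abs continuous_const fun y hy => ?_
  rw [cos_eq_zero_of_abs_eq hy, Real.zero_rpow hr.ne']

theorem hasDerivAt_truncCosPow {r : ℝ} (hr : 1 < r) (y : ℝ) :
    HasDerivAt (truncCosPow r) (-(r * truncCosPow (r - 1) y * Real.sin y)) y := by
  have hcos : HasDerivAt (fun z => Real.cos z ^ r)
      (-Real.sin y * r * Real.cos y ^ (r - 1)) y :=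
    (Real.hasDerivAt_cos y).rpow_const (Or.inr hr.le)
  rcases lt_trichotomy |y| (Real.pi / 2) with h | h | h
  · have hev : truncCosPow r =ᶠ[nhds y] fun z => Real.cos z ^ r := by
      filter_upwards [continuous_abs.continuousAt.eventually_lt_const h] with z hz
      exact if_pos (le_of_lt hz)
    have hr1 : truncCosPow (r - 1) y = Real.cos y ^ (r - 1) := if_pos h.le
    refine (hcos.congr_of_eventuallyEq hev).congr_deriv ?_
    rw [hr1]
    ring
  · have hy := cos_eq_zero_of_abs_eq h
    have hr1 : r - 1 ≠ 0 := by linarith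
    rw [hy, Real.zero_rpow hr1, mul_zero, hasDerivAt_iff_isLittleO] at hcos
    rw [truncCosPow_of_le_abs hr1 h.ge, mul_zero, zero_mul, neg_zero, hasDerivAt_iff_isLittleO]
    refine Asymptotics.IsBigO.trans_isLittleO (Asymptotics.IsBigO.of_bound 1 ?_) hcos
    refine Filter.Eventually.of_forall fun z => ?_
    have hr0 : r ≠ 0 := by linarith
    rw [truncCosPow_of_le_abs hr0 h.ge, hy, Real.zero_rpow hr0]
    simp only [smul_zero, sub_zero, one_mul]
    unfold truncCosPow
    split_ifs
    · exact le_rfl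
    · simp
  · have hev : truncCosPow r =ᶠ[nhds y] fun _ => 0 := by
      filter_upwards [continuous_abs.continuousAt.eventually_const_lt h] with z hz
      exact if_neg (not_le.mpr hz)
    rw [truncCosPow_of_le_abs (by linarith) h.le, mul_zero, zero_mul, neg_zero]
    exact (hasDerivAt_const y 0).congr_of_eventuallyEq hev

theorem truncCosPow_sub_one_mul_cos {r : ℝ} (hr : 1 < r) (y : ℝ) :
    truncCosPow (r - 1) y * Real.cos y = truncCosPow r y := by
  rcases lt_or_ge |y| (Real.pi / 2) with h | h
  · rw [truncCosPow, truncCosPow, if_pos h.le, if_pos h.le]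
    have hc : 0 < Real.cos y := Real.cos_pos_of_mem_Ioo (abs_lt.mp h)
    rw [Real.rpow_sub_one hc.ne']
    field_simp
  · rw [truncCosPow_of_le_abs (by linarith) h, truncCosPow_of_le_abs (by linarith) h, zero_mul]

theorem truncCosPow_rpow {r s : ℝ} (hs : s ≠ 0) (y : ℝ) :
    truncCosPow r y ^ s = truncCosPow (r * s) y := by
  unfold truncCosPow
  split_ifs with h
  · rw [Real.rpow_mul (cos_nonneg_of_abs_le h)]
  · exact Real.zero_rpow hs

theorem contDiff_two_of_hasDerivAt {u u' u'' : ℝ → ℝ} (h₁ : ∀ x, HasDerivAt u (u' x) x)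
    (h₂ : ∀ x, HasDerivAt u' (u'' x) x) (hc : Continuous u'') :
    ContDiff ℝ 2 u ∧ iteratedDeriv 2 u = u'' := by
  have e₁ : deriv u = u' := funext fun x => (h₁ x).deriv
  have e₂ : deriv u' = u'' := funext fun x => (h₂ x).deriv
  constructor
  · rw [show (2 : WithTop ℕ∞) = 1 + 1 by norm_num, contDiff_succ_iff_deriv]
    refine ⟨fun x => (h₁ x).differentiableAt, by simp, ?_⟩
    rw [e₁, contDiff_one_iff_deriv, e₂]
    exact ⟨fun x => (h₂ x).differentiableAt, hc⟩
  · rw [iteratedDeriv_succ, iteratedDeriv_one, e₁, e₂]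

theorem uhat_eq_truncCosPow {p lam : ℝ} (a : ℝ) (hp1 : p < 1) (hlam : 0 < lam) (x : ℝ) :
    uhat a p lam x =
      uH a p lam * truncCosPow (2 / (1 - p)) ((1 - p) * Real.sqrt lam / 2 * x) := by
  have hk : 0 < (1 - p) * Real.sqrt lam := mul_pos (by linarith) (Real.sqrt_pos.mpr hlam)
  have hiff : |x| ≤ TH p lam ↔ |(1 - p) * Real.sqrt lam / 2 * x| ≤ Real.pi / 2 := by
    rw [TH, le_div_iff₀ hk, abs_mul, abs_of_pos (half_pos hk)]
    constructor <;> intro h <;> linarith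
  unfold uhat truncCosPow
  simp only [hiff]
  rw [show (1 - p) * Real.sqrt lam * x / 2 = (1 - p) * Real.sqrt lam / 2 * x by ring]
  split_ifs <;> simp

theorem uH_pos {a p lam : ℝ} (ha : 0 < a) (hp0 : 0 < p) (hlam : 0 < lam) :
    0 < uH a p lam := by
  unfold uH
  positivity

theorem uH_mul_eq {a p lam : ℝ} (ha : 0 < a) (hp0 : 0 < p) (hp1 : p < 1) (hlam : 0 < lam) :
    uH a p lam * ((p + 1) * lam / 2) = a * uH a p lam ^ p := by
  have hU := uH_pos ha hp0 hlam
  have h1 : uH a p lam ^ (1 - p) = 2 * a / ((p + 1) * lam) := by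
    unfold uH
    rw [← Real.rpow_mul (by positivity), one_div_mul_cancel (by linarith), Real.rpow_one]
  have h2 : uH a p lam = uH a p lam ^ (1 - p) * uH a p lam ^ p := by
    rw [← Real.rpow_add hU, sub_add_cancel, Real.rpow_one]
  rw [h1] at h2
  nth_rewrite 1 [h2]
  field_simp

theorem uhat_nonneg {a p lam : ℝ} (ha : 0 < a) (hp0 : 0 < p) (hp1 : p < 1) (hlam : 0 < lam)
    (x : ℝ) : 0 ≤ uhat a p lam x := by
  rw [uhat_eq_truncCosPow a hp1 hlam]
  exact mul_nonneg (uH_pos ha hp0 hlam).le (truncCosPow_nonneg _ _)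

theorem uhat_of_le_abs {p lam x : ℝ} (a : ℝ) (hp1 : p < 1) (h : TH p lam ≤ |x|)
    (hlam : 0 < lam) : uhat a p lam x = 0 := by
  have hs := Real.sqrt_pos.mpr hlam
  have hk : 0 < (1 - p) * Real.sqrt lam := mul_pos (by linarith) hs
  rw [uhat_eq_truncCosPow a hp1 hlam, truncCosPow_of_le_abs, mul_zero]
  · exact (div_pos two_pos (by linarith)).ne'
  · rw [TH, div_le_iff₀ hk] at h
    rw [abs_mul, abs_of_pos (half_pos hk)]
    linarith

theorem contDiff_uhat {a p lam : ℝ} (ha : 0 < a) (hp0 : 0 < p) (hp1 : p < 1)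
    (hlam : 0 < lam) :
    ContDiff ℝ 2 (uhat a p lam) ∧
      ∀ x, iteratedDeriv 2 (uhat a p lam) x + lam * uhat a p lam x
        - a * uhat a p lam x ^ p = 0 := by
  have hp : 0 < 1 - p := by linarith
  have hq : 2 < 2 / (1 - p) := by rw [lt_div_iff₀ hp]; linarith
  have hqp : 2 / (1 - p) * p = 2 / (1 - p) - 1 - 1 := by field_simp; ring
  have hu : uhat a p lam = fun x =>
      uH a p lam * truncCosPow (2 / (1 - p)) ((1 - p) * Real.sqrt lam / 2 * x) :=
    funext (uhat_eq_truncCosPow a hp1 hlam)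
  have hqk : 2 / (1 - p) * ((1 - p) * Real.sqrt lam / 2) = Real.sqrt lam := by field_simp
  have hqk2 : (2 / (1 - p) - 1) * ((1 - p) * Real.sqrt lam / 2) = (p + 1) / 2 * Real.sqrt lam := by
    field_simp; ring
  have hpow := uH_mul_eq ha hp0 hp1 hlam
  have hU := uH_pos ha hp0 hlam
  have hlam2 := Real.mul_self_sqrt hlam.le
  generalize 2 / (1 - p) = q at *
  generalize (1 - p) * Real.sqrt lam / 2 = k at *
  generalize uH a p lam = U at *
  have hlin : ∀ x, HasDerivAt (fun x : ℝ => k * x) k x := fun x => by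
    simpa using (hasDerivAt_id x).const_mul k
  have h₁ : ∀ x, HasDerivAt (fun x => U * truncCosPow q (k * x))
      (U * (-(q * truncCosPow (q - 1) (k * x) * Real.sin (k * x)) * k)) x := fun x =>
    ((hasDerivAt_truncCosPow (by linarith) (k * x)).comp x (hlin x)).const_mul U
  have h₂ : ∀ x, HasDerivAt
      (fun x => U * (-(q * truncCosPow (q - 1) (k * x) * Real.sin (k * x)) * k))
      (U * (-(q * (-((q - 1) * truncCosPow (q - 1 - 1) (k * x) * Real.sin (k * x)) * k)
        * Real.sin (k * x)
        + q * truncCosPow (q - 1) (k * x) * (Real.cos (k * x) * k)) * k)) x := fun x =>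
    (((((hasDerivAt_truncCosPow (r := q - 1) (by linarith) (k * x)).comp x
      (hlin x)).const_mul q).mul ((Real.hasDerivAt_sin (k * x)).comp x
        (hlin x))).neg.mul_const k).const_mul U
  have hlc : Continuous fun x : ℝ => k * x := by fun_prop
  have c₁ : Continuous fun x => truncCosPow (q - 1) (k * x) :=
    (continuous_truncCosPow (by linarith)).comp hlc
  have c₂ : Continuous fun x => truncCosPow (q - 1 - 1) (k * x) :=
    (continuous_truncCosPow (by linarith)).comp hlc
  obtain ⟨hC, hD⟩ := contDiff_two_of_hasDerivAt h₁ h₂ (by fun_prop)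
  rw [hu]
  refine ⟨hC, fun x => ?_⟩
  rw [hD]
  simp only []
  rw [Real.mul_rpow hU.le (truncCosPow_nonneg _ _), truncCosPow_rpow hp0.ne', hqp]
  have e₁ := truncCosPow_sub_one_mul_cos (r := q) (by linarith) (k * x)
  have e₂ := truncCosPow_sub_one_mul_cos (r := q - 1) (by linarith) (k * x)
  have e₃ := Real.sin_sq_add_cos_sq (k * x)
  rw [← e₁, ← e₂]
  generalize truncCosPow (q - 1 - 1) (k * x) = g
  generalize Real.cos (k * x) = c at *
  generalize Real.sin (k * x) = s at *
  have hA : q * k * ((q - 1) * k) = (p + 1) / 2 * lam := by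
    rw [hqk, hqk2]; linear_combination (p + 1) / 2 * hlam2
  have hB : (q * k) * (q * k) = lam := by rw [hqk, hlam2]
  linear_combination (U * g * q * (q - 1) * k ^ 2) * e₃ + U * g * hA
    - (U * g * c ^ 2) * hB + g * hpow

theorem isNonnegSolution_uhat_sub {a L p lam x₀ : ℝ} (ha : 0 < a) (hL : 0 < L) (hp0 : 0 < p)
    (hp1 : p < 1) (hlam : 0 < lam) (hx : x₀ ∈ Set.Icc (TH p lam) (L - TH p lam)) :
    IsNonnegSolution a L p lam (fun x => uhat a p lam (x - x₀)) := by
  obtain ⟨hC, hODE⟩ := contDiff_uhat ha hp0 hp1 hlam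
  have hC' : ContDiff ℝ 2 (fun x => uhat a p lam (x - x₀)) :=
    hC.comp (contDiff_id.sub contDiff_const)
  refine ⟨hC'.contDiffOn, fun x _ => uhat_nonneg ha hp0 hp1 hlam _, ?_, ?_, fun x hxL => ?_⟩
  · refine uhat_of_le_abs a hp1 ?_ hlam
    rw [zero_sub, abs_neg]
    exact hx.1.trans (le_abs_self _)
  · refine uhat_of_le_abs a hp1 ?_ hlam
    exact le_trans (by linarith [hx.2]) (le_abs_self _)
  · rw [iteratedDerivWithin_eq_iteratedDeriv (uniqueDiffOn_Icc hL) hC'.contDiffAt hxL,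
      iteratedDeriv_comp_sub_const]
    exact hODE (x - x₀)

theorem eq_zero_of_uhat_eq_uhat_zero {a p lam x : ℝ} (ha : 0 < a) (hp0 : 0 < p) (hp1 : p < 1)
    (hlam : 0 < lam) (h : uhat a p lam x = uhat a p lam 0) : x = 0 := by
  have hk : 0 < (1 - p) * Real.sqrt lam / 2 :=
    half_pos (mul_pos (by linarith) (Real.sqrt_pos.mpr hlam))
  have hq : 0 < 2 / (1 - p) := div_pos two_pos (by linarith)
  rw [uhat_eq_truncCosPow a hp1 hlam, uhat_eq_truncCosPow a hp1 hlam] at h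
  replace h := mul_left_cancel₀ (uH_pos ha hp0 hlam).ne' h
  have h0 : truncCosPow (2 / (1 - p)) ((1 - p) * Real.sqrt lam / 2 * 0) = 1 := by
    simp [truncCosPow, Real.pi_div_two_pos.le]
  rw [h0, truncCosPow] at h
  split_ifs at h with hy
  · replace h := (Real.rpow_left_inj (cos_nonneg_of_abs_le hy) zero_le_one hq.ne').mp
      (h.trans (Real.one_rpow _).symm)
    have hy' := abs_le.mp hy
    have := (Real.cos_eq_one_iff_of_lt_of_lt (by linarith [Real.pi_pos])
      (by linarith [Real.pi_pos])).mp h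
    exact (mul_eq_zero.mp this).resolve_left hk.ne'
  · exact absurd h zero_ne_one

theorem eq_of_uhat_sub_eqOn {a L p lam x₀ y₀ : ℝ} (ha : 0 < a) (hp0 : 0 < p) (hp1 : p < 1)
    (hlam : 0 < lam) (hx : x₀ ∈ Set.Icc (TH p lam) (L - TH p lam))
    (h : ∀ x ∈ Set.Icc (0 : ℝ) L, uhat a p lam (x - x₀) = uhat a p lam (x - y₀)) :
    x₀ = y₀ := by
  have hT : 0 ≤ TH p lam :=
    div_nonneg Real.pi_pos.le (mul_nonneg (by linarith) (Real.sqrt_nonneg _))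
  have h' := h x₀ ⟨hT.trans hx.1, by linarith [hx.2]⟩
  rw [sub_self] at h'
  exact sub_eq_zero.mp (eq_zero_of_uhat_eq_uhat_zero ha hp0 hp1 hlam h'.symm)

theorem not_countable_Icc {b c : ℝ} (h : b < c) : ¬ (Set.Icc b c).Countable := fun hc => by
  have h0 := hc.measure_zero MeasureTheory.volume
  rw [Real.volume_Icc, ENNReal.ofReal_eq_zero] at h0
  linarith

theorem two_mul_TH_lt {L p lam : ℝ} (hL : 0 < L) (hp1 : p < 1) (hlam : 0 < lam)
    (h : (2 / (1 - p)) ^ 2 * (Real.pi / L) ^ 2 < lam) : 2 * TH p lam < L := by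
  have hp : 0 < 1 - p := by linarith
  have hs := Real.sqrt_pos.mpr hlam
  rw [← mul_pow] at h
  have h' := Real.lt_sqrt_of_sq_lt h
  rw [div_mul_div_comm, div_lt_iff₀ (mul_pos hp hL)] at h'
  rw [TH, ← mul_div_assoc, div_lt_iff₀ (mul_pos hp hs)]
  linarith

theorem stmt4 (a L p lam : ℝ) (ha : 0 < a) (hL : 0 < L) (hp0 : 0 < p) (hp1 : p < 1)
    (hlam : 0 < lam) (h2T : 2 * TH p lam ≤ L) :
    (∀ x₀ ∈ Set.Icc (TH p lam) (L - TH p lam),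
      IsNonnegSolution a L p lam (fun x => uhat a p lam (x - x₀))) ∧
    (∀ x₀ ∈ Set.Icc (TH p lam) (L - TH p lam),
      ∀ y₀ ∈ Set.Icc (TH p lam) (L - TH p lam),
      (∀ x ∈ Set.Icc (0 : ℝ) L, uhat a p lam (x - x₀) = uhat a p lam (x - y₀)) → x₀ = y₀) ∧
    ((2 / (1 - p)) ^ 2 * (Real.pi / L) ^ 2 < lam →
      ∃ S : Set (ℝ → ℝ), ¬ S.Countable ∧
        (∀ u ∈ S, IsNonnegSolution a L p lam u) ∧
        (∀ u ∈ S, ∀ v ∈ S, (∀ x ∈ Set.Icc (0 : ℝ) L, u x = v x) → u = v)) := by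
  have hsol := fun x₀ hx =>
    isNonnegSolution_uhat_sub (x₀ := x₀) ha hL hp0 hp1 hlam hx
  refine ⟨hsol, fun x₀ hx y₀ _ h => eq_of_uhat_sub_eqOn ha hp0 hp1 hlam hx h, fun hlt => ?_⟩
  refine ⟨(fun x₀ x => uhat a p lam (x - x₀)) '' Set.Icc (TH p lam) (L - TH p lam), ?_, ?_, ?_⟩
  · intro hc
    have hT := two_mul_TH_lt hL hp1 hlam hlt
    refine not_countable_Icc (by linarith)
      (Set.countable_of_injective_of_countable_image (fun x₀ hx y₀ _ h => ?_) hc)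
    exact eq_of_uhat_sub_eqOn ha hp0 hp1 hlam hx fun x _ => congrFun h x
  · rintro _ ⟨x₀, hx, rfl⟩
    exact hsol x₀ hx
  · rintro _ ⟨x₀, hx, rfl⟩ _ ⟨y₀, -, rfl⟩ h
    rw [eq_of_uhat_sub_eqOn ha hp0 hp1 hlam hx h]
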